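/- Let M be a compact Sasakian manifold. (i) If ω ∈ Ω^{p,4ν}_{δ, ε_η, i_ξ d}(M) then dω ∈ Ω^{p+1,4ν}_{d, i_ξ, ε_ηδ}(M), and if moreover ν ≠ 0 then dω ≠ 0. (ii) If ω ∈ Ω^{p,4ν}_{d, i_ξ, ε_ηδ}(M) then δω ∈ Ω^{p-1,4ν}_{δ, ε_η, i_ξ d}(M), and if moreover ν ≠ 0 then δω ≠ 0. Consequently, for ν ≠ 0 and 0 ≤ p ≤ 2n, the maps d : Ω^{p,4ν}_{δ, ε_η, i_ξ d}(M) → Ω^{p+1,4ν}_{d, i_ξ, ε_ηδ}(M) and δ in the opposite direction are isomorphisms. -/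

import Mathlib

/-!
Abstract "package" formalization of the de Rham complex of a (compact)
contact / Sasakian manifold of dimension `2n+1`.

`V` plays the role of the full de Rham algebra `Ω^*(M)`, `Ω p` is the
subspace of `p`-forms (zero outside `0 ≤ p ≤ 2n+1`), and the fields are the
canonical operators together with their standard structural identities.
-/

universe u

/-- The de Rham complex of a (strict) contact manifold `(M, η)` of dimension
`2n+1`, with the operators determined by the contact form: the exterior
differential `d`, the wedge product `ε_η` with `η`, the interior product
`i_ξ` with the Reeb vector field `ξ`, and the Lefschetz operator `L`
(wedge product with `Φ = ½ dη`). -/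
structure ContactPackage (n : ℕ) (V : Type u) [AddCommGroup V] [Module ℝ V] where
  /-- the space of `p`-forms -/
  Ω : ℤ → Submodule ℝ V
  /-- exterior differential -/
  d : Module.End ℝ V
  /-- wedge product with the contact form `η` -/
  εη : Module.End ℝ V
  /-- interior product with the Reeb vector field `ξ` -/
  iξ : Module.End ℝ V
  /-- the Lefschetz operator: wedge product with `Φ = ½ dη` -/
  L : Module.End ℝ V
  omega_bot_neg : ∀ p : ℤ, p < 0 → Ω p = ⊥
  omega_bot_big : ∀ p : ℤ, (2 * n + 1 : ℤ) < p → Ω p = ⊥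
  iSup_omega : (⨆ p : ℤ, Ω p) = ⊤
  d_mem : ∀ p : ℤ, ∀ ω ∈ Ω p, d ω ∈ Ω (p + 1)
  εη_mem : ∀ p : ℤ, ∀ ω ∈ Ω p, εη ω ∈ Ω (p + 1)
  iξ_mem : ∀ p : ℤ, ∀ ω ∈ Ω p, iξ ω ∈ Ω (p - 1)
  L_mem : ∀ p : ℤ, ∀ ω ∈ Ω p, L ω ∈ Ω (p + 2)
  d_d : d * d = 0
  εη_εη : εη * εη = 0
  iξ_iξ : iξ * iξ = 0
  /-- `{i_ξ, ε_η} = 1`, i.e. `i_ξ η = 1` -/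
  anticomm_iξ_εη : iξ * εη + εη * iξ = 1
  /-- `{d, ε_η} = ε_{dη} = 2 L` -/
  anticomm_d_εη : d * εη + εη * d = 2 • L
  /-- `i_ξ dη = 0` -/
  comm_iξ_L : iξ * L = L * iξ

namespace ContactPackage
variable {n : ℕ} {V : Type u} [AddCommGroup V] [Module ℝ V]

/-- Lie derivative along the Reeb vector field (Cartan's magic formula). -/
def Lξ (C : ContactPackage n V) : Module.End ℝ V := C.d * C.iξ + C.iξ * C.d

end ContactPackage

/-- The de Rham complex of a Sasakian manifold `(M, η, g)` of dimension
`2n+1`: a contact package together with the codifferential `δ`, the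
degree-zero derivation `i_φ` induced by the `(1,1)`-tensor `φ`, and the
Hodge star operator of the Sasakian metric. -/
structure SasakianPackage (n : ℕ) (V : Type u) [AddCommGroup V] [Module ℝ V]
    extends ContactPackage n V where
  /-- codifferential -/
  δ : Module.End ℝ V
  /-- the degree-zero derivation `i_φ` induced by `φ` -/
  iφ : Module.End ℝ V
  /-- Hodge star operator of the Sasakian metric -/
  hstar : Module.End ℝ V
  δ_mem : ∀ p : ℤ, ∀ ω ∈ Ω p, δ ω ∈ Ω (p - 1)
  iφ_mem : ∀ p : ℤ, ∀ ω ∈ Ω p, iφ ω ∈ Ω p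
  hstar_mem : ∀ p : ℤ, ∀ ω ∈ Ω p, hstar ω ∈ Ω (2 * n + 1 - p)
  hstar_hstar : hstar * hstar = 1
  δ_hstar : ∀ p : ℤ, ∀ ω ∈ Ω p, δ (hstar ω) = ((-1 : ℝ) ^ (p + 1)) • hstar (d ω)

namespace SasakianPackage
variable {n : ℕ} {V : Type u} [AddCommGroup V] [Module ℝ V]

/-- Hodge Laplacian `Δ = dδ + δd`. -/
def Δ (S : SasakianPackage n V) : Module.End ℝ V := S.d * S.δ + S.δ * S.d

/-- Frölicher–Nijenhuis Lie derivative along `φ`:  `𝓛_φ = i_φ d − d i_φ`. -/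
def Lφ (S : SasakianPackage n V) : Module.End ℝ V := S.iφ * S.d - S.d * S.iφ

/-- The space `Ω^p_Δ(M)` of harmonic `p`-forms. -/
def Harm (S : SasakianPackage n V) (p : ℤ) : Submodule ℝ V :=
  S.Ω p ⊓ LinearMap.ker S.Δ

/-- `Ω^{p,ν}_{d, i_ξ, ε_η δ}(M)`:  `p`-forms `ω` with `Δω = ν ω`,
`dω = 0`, `i_ξ ω = 0` and `ε_η δ ω = 0`. -/
def ΩA (S : SasakianPackage n V) (p : ℤ) (ν : ℝ) : Set V :=
  {ω | ω ∈ S.Ω p ∧ S.Δ ω = ν • ω ∧ S.d ω = 0 ∧ S.iξ ω = 0 ∧ S.εη (S.δ ω) = 0}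

/-- `Ω^{p,ν}_{δ, ε_η, i_ξ d}(M)`:  `p`-forms `ω` with `Δω = ν ω`,
`δω = 0`, `ε_η ω = 0` and `i_ξ d ω = 0`. -/
def ΩB (S : SasakianPackage n V) (p : ℤ) (ν : ℝ) : Set V :=
  {ω | ω ∈ S.Ω p ∧ S.Δ ω = ν • ω ∧ S.δ ω = 0 ∧ S.εη ω = 0 ∧ S.iξ (S.d ω) = 0}

end SasakianPackage

/-- The de Rham complex of a **compact** Sasakian manifold: a Sasakian
package together with the global `L²` scalar product of forms, with respect
to which `δ`, `ε_η` and `Λ` are the formal adjoints of `d`, `i_ξ` and `L`. -/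
structure CompactSasakianPackage (n : ℕ) (V : Type u) [AddCommGroup V] [Module ℝ V]
    extends SasakianPackage n V where
  /-- the global `L²` scalar product of forms -/
  inner : V →ₗ[ℝ] V →ₗ[ℝ] ℝ
  /-- the dual Lefschetz operator `Λ = L^*` -/
  Λ : Module.End ℝ V
  Λ_mem : ∀ p : ℤ, ∀ ω ∈ Ω p, Λ ω ∈ Ω (p - 2)
  inner_symm : ∀ a b, inner a b = inner b a
  inner_pos : ∀ a, a ≠ 0 → 0 < inner a a
  /-- `δ = d^*` -/
  adj_d : ∀ a b, inner (d a) b = inner a (δ b)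
  /-- `ε_η = i_ξ^*` -/
  adj_iξ : ∀ a b, inner (iξ a) b = inner a (εη b)
  /-- `Λ = L^*` -/
  adj_L : ∀ a b, inner (L a) b = inner a (Λ b)

namespace CompactSasakianPackage
variable {n : ℕ} {V : Type u} [AddCommGroup V] [Module ℝ V]

theorem d_d_apply (S : CompactSasakianPackage n V) (a : V) : S.d (S.d a) = 0 :=
  LinearMap.congr_fun S.d_d a

theorem δ_δ_apply (S : CompactSasakianPackage n V) (a : V) : S.δ (S.δ a) = 0 := by
  by_contra h
  have hpos := S.inner_pos _ h
  rw [← S.adj_d, ← S.adj_d, d_d_apply, map_zero, LinearMap.zero_apply] at hpos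
  exact lt_irrefl _ hpos

theorem Δ_apply (S : CompactSasakianPackage n V) (a : V) :
    S.Δ a = S.d (S.δ a) + S.δ (S.d a) := rfl

theorem Δ_d_apply (S : CompactSasakianPackage n V) (a : V) : S.Δ (S.d a) = S.d (S.Δ a) := by
  simp [Δ_apply, d_d_apply]

theorem Δ_δ_apply (S : CompactSasakianPackage n V) (a : V) : S.Δ (S.δ a) = S.δ (S.Δ a) := by
  simp [Δ_apply, δ_δ_apply]

theorem δ_d_of_mem_ΩB (S : CompactSasakianPackage n V) {p : ℤ} {μ : ℝ} {ω : V}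
    (h : ω ∈ S.ΩB p μ) : S.δ (S.d ω) = μ • ω := by
  have := h.2.1
  rwa [Δ_apply, h.2.2.1, map_zero, zero_add] at this

theorem d_δ_of_mem_ΩA (S : CompactSasakianPackage n V) {p : ℤ} {μ : ℝ} {ω : V}
    (h : ω ∈ S.ΩA p μ) : S.d (S.δ ω) = μ • ω := by
  have := h.2.1
  rwa [Δ_apply, h.2.2.1, map_zero, add_zero] at this

theorem d_mem_ΩA (S : CompactSasakianPackage n V) {p : ℤ} {μ : ℝ} {ω : V}
    (h : ω ∈ S.ΩB p μ) : S.d ω ∈ S.ΩA (p + 1) μ := by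
  refine ⟨S.d_mem p ω h.1, ?_, S.d_d_apply ω, h.2.2.2.2, ?_⟩
  · rw [Δ_d_apply, h.2.1, map_smul]
  · rw [δ_d_of_mem_ΩB S h, map_smul, h.2.2.2.1, smul_zero]

theorem δ_mem_ΩB (S : CompactSasakianPackage n V) {p : ℤ} {μ : ℝ} {ω : V}
    (h : ω ∈ S.ΩA p μ) : S.δ ω ∈ S.ΩB (p - 1) μ := by
  refine ⟨S.δ_mem p ω h.1, ?_, S.δ_δ_apply ω, h.2.2.2.2, ?_⟩
  · rw [Δ_δ_apply, h.2.1, map_smul]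
  · rw [d_δ_of_mem_ΩA S h, map_smul, h.2.2.2.1, smul_zero]

theorem smul_mem_ΩA (S : CompactSasakianPackage n V) {p : ℤ} {μ : ℝ} {ω : V} (c : ℝ)
    (h : ω ∈ S.ΩA p μ) : c • ω ∈ S.ΩA p μ := by
  obtain ⟨h₁, h₂, h₃, h₄, h₅⟩ := h
  exact ⟨(S.Ω p).smul_mem c h₁, by rw [map_smul, h₂, smul_comm], by simp [h₃], by simp [h₄],
    by simp [h₅]⟩

theorem smul_mem_ΩB (S : CompactSasakianPackage n V) {p : ℤ} {μ : ℝ} {ω : V} (c : ℝ)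
    (h : ω ∈ S.ΩB p μ) : c • ω ∈ S.ΩB p μ := by
  obtain ⟨h₁, h₂, h₃, h₄, h₅⟩ := h
  exact ⟨(S.Ω p).smul_mem c h₁, by rw [map_smul, h₂, smul_comm], by simp [h₃], by simp [h₄],
    by simp [h₅]⟩

end CompactSasakianPackage

/-- (Proposition `propddelta` and the isomorphisms (3.1)).  On a compact
Sasakian manifold of dimension `2n+1`:
(i) `d` maps `Ω^{p,4ν}_{δ, ε_η, i_ξ d}(M)` into `Ω^{p+1,4ν}_{d, i_ξ, ε_η δ}(M)`,
and for `ν ≠ 0` it is injective there;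
(ii) `δ` maps `Ω^{p,4ν}_{d, i_ξ, ε_η δ}(M)` into `Ω^{p-1,4ν}_{δ, ε_η, i_ξ d}(M)`,
and for `ν ≠ 0` it is injective there;
consequently, for `ν ≠ 0` and `0 ≤ p ≤ 2n`, the maps `d` and `δ` are
isomorphisms between `Ω^{p,4ν}_{δ, ε_η, i_ξ d}(M)` and
`Ω^{p+1,4ν}_{d, i_ξ, ε_η δ}(M)`. -/
theorem d_delta_isomorphisms
    {V : Type u} [AddCommGroup V] [Module ℝ V] {n : ℕ}
    (S : CompactSasakianPackage n V) (p : ℤ) (ν : ℝ) :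
    (∀ ω ∈ S.ΩB p (4 * ν),
        S.d ω ∈ S.ΩA (p + 1) (4 * ν) ∧ (ν ≠ 0 → ω ≠ 0 → S.d ω ≠ 0)) ∧
    (∀ ω ∈ S.ΩA p (4 * ν),
        S.δ ω ∈ S.ΩB (p - 1) (4 * ν) ∧ (ν ≠ 0 → ω ≠ 0 → S.δ ω ≠ 0)) ∧
    (ν ≠ 0 → 0 ≤ p → p ≤ 2 * (n : ℤ) →
      Set.BijOn (fun ω => S.d ω) (S.ΩB p (4 * ν)) (S.ΩA (p + 1) (4 * ν)) ∧
      Set.BijOn (fun ω => S.δ ω) (S.ΩA (p + 1) (4 * ν)) (S.ΩB p (4 * ν))) := by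
  have hδ : ∀ ω ∈ S.ΩA (p + 1) (4 * ν), S.δ ω ∈ S.ΩB p (4 * ν) := fun ω hω => by
    simpa using S.δ_mem_ΩB hω
  refine ⟨fun ω hω => ⟨S.d_mem_ΩA hω, fun hν h₀ hd => ?_⟩,
    fun ω hω => ⟨S.δ_mem_ΩB hω, fun hν h₀ hd => ?_⟩,
    fun hν _ _ => ⟨⟨fun ω hω => S.d_mem_ΩA hω, fun a ha b hb hab => ?_, fun ω hω => ?_⟩,
      ⟨hδ, fun a ha b hb hab => ?_, fun ω hω => ?_⟩⟩⟩ <;>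
    have hμ : 4 * ν ≠ 0 := mul_ne_zero four_ne_zero hν
  · have h := S.δ_d_of_mem_ΩB hω
    rw [hd, map_zero] at h
    exact smul_ne_zero hμ h₀ h.symm
  · have h := S.d_δ_of_mem_ΩA hω
    rw [hd, map_zero] at h
    exact smul_ne_zero hμ h₀ h.symm
  · have h := congrArg S.δ hab
    simp only [S.δ_d_of_mem_ΩB ha, S.δ_d_of_mem_ΩB hb] at h
    exact smul_right_injective V hμ h
  · refine ⟨(4 * ν)⁻¹ • S.δ ω, S.smul_mem_ΩB _ (hδ ω hω), ?_⟩
    simp only [map_smul, S.d_δ_of_mem_ΩA hω, inv_smul_smul₀ hμ]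
  · have h := congrArg S.d hab
    simp only [S.d_δ_of_mem_ΩA ha, S.d_δ_of_mem_ΩA hb] at h
    exact smul_right_injective V hμ h
  · refine ⟨(4 * ν)⁻¹ • S.d ω, S.smul_mem_ΩA _ (S.d_mem_ΩA hω), ?_⟩
    simp only [map_smul, S.δ_d_of_mem_ΩB hω, inv_smul_smul₀ hμ]
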